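/- Ordering of bifurcation angular momenta for the two-body problem: for all I_s ≥ 0.4, (16/(3√3))√I_s < 4√I_s(1+I_s)/(√(1+I_s)+√I_s) < (1+I_s)². -/

import Mathlib

theorem full_two_body_bifurcation_ordering
    (Is : ℝ) (hIs : Is ≥ 0.4) :
    16 / (3 * Real.sqrt 3) * Real.sqrt Is <
        4 * Real.sqrt Is * (1 + Is) / (Real.sqrt (1 + Is) + Real.sqrt Is) ∧
      4 * Real.sqrt Is * (1 + Is) / (Real.sqrt (1 + Is) + Real.sqrt Is) < (1 + Is) ^ 2 := by
  have h4 : (2 : ℝ) / 5 ≤ Is := by norm_num at hIs ⊢; linarith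
  have hI : 0 < Is := by linarith
  have ha : 0 < Real.sqrt Is := Real.sqrt_pos.2 hI
  have hb : 0 < Real.sqrt (1 + Is) := Real.sqrt_pos.2 (by linarith)
  have hs : 0 < Real.sqrt 3 := Real.sqrt_pos.2 (by norm_num)
  have ha2 : Real.sqrt Is ^ 2 = Is := Real.sq_sqrt hI.le
  have hb2 : Real.sqrt (1 + Is) ^ 2 = 1 + Is := Real.sq_sqrt (by linarith)
  have hs2 : Real.sqrt 3 ^ 2 = 3 := Real.sq_sqrt (by norm_num)
  set a := Real.sqrt Is
  set b := Real.sqrt (1 + Is)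
  set s := Real.sqrt 3
  have hpos : 0 < (3 * Is - 1) ^ 2 := by
    have : 0 < 3 * Is - 1 := by linarith
    positivity
  constructor
  · have h1 : 32 * (a * b) < 27 * Is ^ 2 + 22 * Is + 11 := by
      apply lt_of_pow_lt_pow_left₀ 2 (by positivity)
      have e : (32 * (a * b)) ^ 2 = 1024 * (Is * (1 + Is)) := by
        rw [mul_pow, mul_pow, ha2, hb2]; norm_num
      rw [e]
      have : 0 < (3 * Is - 1) ^ 2 * (81 * Is ^ 2 + 186 * Is + 121) := by positivity
      nlinarith
    have h2 : 4 * (a + b) < 3 * s * (1 + Is) := by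
      apply lt_of_pow_lt_pow_left₀ 2 (by positivity)
      have e : (4 * (a + b)) ^ 2 = 16 * (1 + 2 * Is) + 32 * (a * b) := by
        linear_combination 16 * ha2 + 16 * hb2
      have e' : (3 * s * (1 + Is)) ^ 2 = 27 * (1 + Is) ^ 2 := by
        rw [mul_pow, mul_pow, hs2]; norm_num
      rw [e, e']
      nlinarith
    rw [div_mul_eq_mul_div, div_lt_div_iff₀ (by positivity) (by positivity)]
    have := mul_lt_mul_of_pos_left h2 (by positivity : 0 < 4 * a)
    nlinarith
  · have h1 : a * (3 - Is) < b * (1 + Is) := by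
      apply lt_of_pow_lt_pow_left₀ 2 (by positivity)
      rw [mul_pow, mul_pow, ha2, hb2]
      nlinarith
    rw [div_lt_iff₀ (by positivity)]
    have := mul_lt_mul_of_pos_left h1 (by positivity : 0 < 1 + Is)
    nlinarith
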